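/- Suppose K has characteristic not two and a_1 = 0. Set d = Σ_{j=1}^{n+2} b_j − Σ_{i=1}^n a_i, d' = Σ_{i=1}^n (b_i − a_i), and c = d − 3. If either (a) d is even and d' + b_{n+1} + 2 > b_{n+2}, or (b) d is odd and d' + b_{n+1} + 1 > b_{n+2}, then the Hilbert function of M is strictly unimodal with maximum at ⌊c/2⌋: h_M(t) < h_M(t+1) for all 0 ≤ t < ⌊c/2⌋, and h_M(t) = h_M(c − t) for all t (so h_M is strictly decreasing for ⌈c/2⌉ ≤ t ≤ c). -/

import Mathlib

open MvPolynomial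

noncomputable section

/-- The height (codimension) of an ideal: the infimum of the heights of the
prime ideals containing it. -/
def idealHeight {R : Type*} [CommRing R] (I : Ideal R) : ℕ∞ :=
  ⨅ (p : PrimeSpectrum R) (_ : I ≤ p.asIdeal), Order.height p

/-- The degree-`z` homogeneous component of `K[x₁, …, x_r]`, for `z : ℤ`
(it is zero in negative degrees). -/
def hcomp (K : Type*) [Field K] (r : ℕ) (z : ℤ) : Submodule K (MvPolynomial (Fin r) K) :=
  if 0 ≤ z then homogeneousSubmodule (Fin r) K z.toNat else ⊥

/-- The degree-`t` graded piece of the cokernel `M` of the graded map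
`φ : ⊕_j R(-b j) → ⊕_i R(-a i)`. -/
def cokerPiece {K : Type*} [Field K] {n m : ℕ}
    (φ : Matrix (Fin n) (Fin m) (MvPolynomial (Fin 3) K)) (a : Fin n → ℤ) (t : ℤ) :
    Submodule K ((Fin n → MvPolynomial (Fin 3) K) ⧸ LinearMap.range φ.mulVecLin) :=
  (Submodule.pi Set.univ fun i => hcomp K 3 (t - a i)).map
    ((LinearMap.range φ.mulVecLin).mkQ.restrictScalars K)

end

section

open Matrix

section Acyclicity

/-- The Koszul syzygy conditions on three elements which make a complex of free modules of
length three acyclic when they annihilate its homology. -/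
structure IsKoszulRegular {R : Type*} [CommRing R] (f g h : R) : Prop where
  ne_zero : f ≠ 0
  dvd_of_mul_eq_mul : ∀ p q, g * p = f * q → f ∣ p
  exists_of_mul_eq : ∀ u p q, h * u = g * p - f * q → ∃ p' q', u = g * p' - f * q'

theorem exists_eq_smul_of_smul_eq_smul {R κ : Type*} [CommRing R] {f g : R}
    (hfg : ∀ p q, g * p = f * q → f ∣ p) (w w' : κ → R) (h : g • w = f • w') :
    ∃ w'', w = f • w'' := by
  have : ∀ k, f ∣ w k := fun k => hfg _ (w' k) (congrFun h k)
  choose w'' hw'' using this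
  exact ⟨w'', funext hw''⟩

variable {R : Type*} [CommRing R] [IsDomain R]

theorem mem_range_of_smul_mem_range_of_injective {ι κ : Type*}
    {f g h : R} (H : IsKoszulRegular f g h)
    (D : (ι → R) →ₗ[R] (κ → R)) (hD : Function.Injective D) {v : κ → R}
    (h1 : f • v ∈ LinearMap.range D) (h2 : g • v ∈ LinearMap.range D) :
    v ∈ LinearMap.range D := by
  obtain ⟨w, hw⟩ := h1
  obtain ⟨w', hw'⟩ := h2
  obtain ⟨w'', rfl⟩ := exists_eq_smul_of_smul_eq_smul H.dvd_of_mul_eq_mul w w'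
    (hD (by rw [map_smul, map_smul, hw, hw', smul_comm]))
  refine ⟨w'', ?_⟩
  rw [map_smul] at hw
  exact smul_right_injective _ H.ne_zero hw

theorem mem_range_of_smul_mem_range_of_exact {ι κ M : Type*} [AddCommGroup M] [Module R M]
    [Module.IsTorsionFree R M]
    {f g h : R} (H : IsKoszulRegular f g h)
    (D : (ι → R) →ₗ[R] (κ → R)) (hD : Function.Injective D)
    (E : (κ → R) →ₗ[R] M) (hDE : LinearMap.ker E = LinearMap.range D) {v : M}
    (h1 : f • v ∈ LinearMap.range E) (h2 : g • v ∈ LinearMap.range E)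
    (h3 : h • v ∈ LinearMap.range E) :
    v ∈ LinearMap.range E := by
  obtain ⟨w1, hw1⟩ := h1
  obtain ⟨w2, hw2⟩ := h2
  obtain ⟨w3, hw3⟩ := h3
  obtain ⟨u12, hu12⟩ := hDE.le (show g • w1 - f • w2 ∈ LinearMap.ker E by
    rw [LinearMap.mem_ker, map_sub, map_smul, map_smul, hw1, hw2, smul_comm, sub_self])
  obtain ⟨u13, hu13⟩ := hDE.le (show h • w1 - f • w3 ∈ LinearMap.ker E by
    rw [LinearMap.mem_ker, map_sub, map_smul, map_smul, hw1, hw3, smul_comm, sub_self])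
  obtain ⟨u23, hu23⟩ := hDE.le (show h • w2 - g • w3 ∈ LinearMap.ker E by
    rw [LinearMap.mem_ker, map_sub, map_smul, map_smul, hw2, hw3, smul_comm, sub_self])
  have hu : h • u12 = g • u13 - f • u23 := by
    apply hD
    rw [map_sub, map_smul, map_smul, map_smul, hu12, hu13, hu23]
    module
  choose p q hpq using fun i => H.exists_of_mul_eq (u12 i) (u13 i) (u23 i) (congrFun hu i)
  have hpq' : u12 = g • p - f • q := funext hpq
  rw [hpq', map_sub, map_smul, map_smul] at hu12
  obtain ⟨w, hw⟩ := exists_eq_smul_of_smul_eq_smul H.dvd_of_mul_eq_mul (w1 - D p) (w2 - D q) (by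
    rw [smul_sub, smul_sub, sub_eq_sub_iff_sub_eq_sub, ← hu12])
  have hED : ∀ p, E (D p) = 0 := fun p =>
    LinearMap.mem_ker.1 (hDE.ge ⟨p, rfl⟩)
  refine ⟨w, smul_right_injective _ H.ne_zero ?_⟩
  show f • E w = f • v
  rw [← map_smul, ← hw, map_sub, hED, sub_zero, hw1]

end Acyclicity

section Complex

variable {R : Type*}

/-- The matrix obtained from `A` by adding `p` as a new first row. -/
def consRow {α : Type*} {m : ℕ} (p : α → R) (A : Matrix (Fin m) α R) :
    Matrix (Fin (m + 1)) α R :=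
  Matrix.of (Fin.cons p A)

@[simp]
theorem consRow_zero {α : Type*} {m : ℕ} (p : α → R) (A : Matrix (Fin m) α R) :
    consRow p A 0 = p := rfl

@[simp]
theorem consRow_succ {α : Type*} {m : ℕ} (p : α → R) (A : Matrix (Fin m) α R) (i : Fin m) :
    consRow p A i.succ = A i := rfl

theorem updateRow_consRow_zero {α : Type*} {m : ℕ} (p v : α → R) (A : Matrix (Fin m) α R) :
    (consRow p A).updateRow 0 v = consRow v A :=
  Fin.update_cons_zero (α := fun _ => α → R) _ _ _

theorem updateRow_consRow_succ {α : Type*} {m : ℕ} (p v : α → R) (A : Matrix (Fin m) α R)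
    (i : Fin m) : (consRow p A).updateRow i.succ v = consRow p (A.updateRow i v) :=
  (Fin.cons_update (α := fun _ => α → R) _ _ _ _).symm

variable [CommRing R] {n : ℕ}

/-- The skew-symmetric matrix of signed maximal minors of an `n × (n + 2)` matrix. -/
def skewMinors (φ : Matrix (Fin n) (Fin (n + 2)) R) : Matrix (Fin (n + 2)) (Fin (n + 2)) R :=
  Matrix.of fun j k => (consRow (Pi.single j 1) (consRow (Pi.single k 1) φ)).det

theorem skewMinors_apply (φ : Matrix (Fin n) (Fin (n + 2)) R) (j k : Fin (n + 2)) :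
    skewMinors φ j k = (consRow (Pi.single j 1) (consRow (Pi.single k 1) φ)).det := rfl

theorem Fin.exists_cons_injective {α : Type*} [Fintype α] {m : ℕ} (g : Fin m → α)
    (hg : Function.Injective g) (hm : m < Fintype.card α) :
    ∃ j, Function.Injective (Fin.cons j g : Fin (m + 1) → α) := by
  have : ¬ Function.Surjective g := fun h => by
    have := Fintype.card_le_of_surjective g h
    simp at this; omega
  simp only [Function.Surjective, not_forall] at this
  obtain ⟨j, hj⟩ := this
  exact ⟨j, Fin.cons_injective_iff.2 ⟨fun ⟨i, hi⟩ => hj ⟨i, hi⟩, hg⟩⟩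

theorem det_consRow_single_submatrix {α : Type*} [DecidableEq α] {m : ℕ} (τ : Fin (m + 1) → α)
    (hτ : Function.Injective τ) (A : Matrix (Fin m) α R) :
    ((consRow (Pi.single (τ 0) 1) A).submatrix id τ).det =
      (A.submatrix id (τ ∘ Fin.succ)).det := by
  rw [det_succ_row_zero, Finset.sum_eq_single 0]
  · simp [Matrix.submatrix]
  · intro k _ hk
    simp [hτ.ne hk]
  · simp

theorem det_submatrix_mem_span_skewMinors (φ : Matrix (Fin n) (Fin (n + 2)) R)
    (g : Fin n → Fin (n + 2)) (hg : Function.Injective g) :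
    (φ.submatrix id g).det ∈ Ideal.span (Set.range fun p : Fin (n + 2) × Fin (n + 2) =>
      skewMinors φ p.1 p.2) := by
  obtain ⟨k, hk⟩ := Fin.exists_cons_injective g hg (by simp)
  obtain ⟨j, hj⟩ := Fin.exists_cons_injective _ hk (by simp)
  have h1 := det_consRow_single_submatrix _ hj (consRow (Pi.single k 1) φ)
  have h2 := det_consRow_single_submatrix _ hk φ
  let σ : Equiv.Perm (Fin (n + 2)) := Equiv.ofBijective _ (Finite.injective_iff_bijective.1 hj)
  have h3 := Matrix.det_permute' σ (consRow (Pi.single j 1) (consRow (Pi.single k 1) φ))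
  have h4 : (φ.submatrix id g).det = ((Equiv.Perm.sign σ : ℤ) : R) * skewMinors φ j k :=
    h2.symm.trans (h1.symm.trans h3)
  rw [h4]
  exact Ideal.mul_mem_left _ _ (Ideal.subset_span ⟨(j, k), rfl⟩)

theorem det_updateRow_eq_sum {m : Type*} [Fintype m] [DecidableEq m] (A : Matrix m m R) (i : m)
    (v : m → R) : (A.updateRow i v).det = ∑ k, (A.updateRow i (Pi.single k 1)).det * v k := by
  rw [← cramer_transpose_apply, cramer_eq_adjugate_mulVec, ← adjugate_transpose]
  simp only [mulVec, dotProduct, transpose_apply, adjugate_apply]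

theorem det_smul_eq_sum {m : Type*} [Fintype m] [DecidableEq m] (A : Matrix m m R)
    (v : m → R) : A.det • v = ∑ i, (A.updateRow i v).det • A i := by
  have := mulVec_cramer Aᵀ v
  rw [det_transpose] at this
  rw [← this]
  ext k
  simp [mulVec, dotProduct, cramer_transpose_apply, mul_comm]

theorem det_smul_eq_sum_adjugate {m : Type*} [Fintype m] [DecidableEq m] (A : Matrix m m R)
    (v : m → R) (l : m) :
    A.det * v l = ∑ i, (A.updateRow i (Pi.single l 1)).det * (A *ᵥ v) i := by
  have : A.adjugate *ᵥ (A *ᵥ v) = A.det • v := by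
    rw [mulVec_mulVec, adjugate_mul, smul_mulVec, one_mulVec]
  simpa [mulVec, dotProduct, adjugate_apply] using (congrFun this l).symm

theorem consRow_mulVec_zero {m k : ℕ} (p v : Fin k → R) (A : Matrix (Fin m) (Fin k) R) :
    (consRow p A *ᵥ v) 0 = p ⬝ᵥ v := rfl

theorem consRow_mulVec_succ {m k : ℕ} (p v : Fin k → R) (A : Matrix (Fin m) (Fin k) R)
    (i : Fin m) : (consRow p A *ᵥ v) i.succ = (A *ᵥ v) i := rfl

theorem det_consRow_swap (φ : Matrix (Fin n) (Fin (n + 2)) R) (p q : Fin (n + 2) → R) :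
    (consRow q (consRow p φ)).det = - (consRow p (consRow q φ)).det := by
  have := det_permute (Equiv.swap (0 : Fin (n + 2)) 1) (consRow p (consRow q φ))
  rw [Equiv.Perm.sign_swap (by simp)] at this
  have h2 : (consRow p (consRow q φ)).submatrix (Equiv.swap (0 : Fin (n + 2)) 1) id =
      consRow q (consRow p φ) := by
    ext i l
    refine Fin.cases ?_ (fun i => Fin.cases ?_ (fun i => ?_) i) i
    · simp only [submatrix_apply, Equiv.swap_apply_left, id]
      rfl
    · simp only [submatrix_apply, Fin.succ_zero_eq_one, Equiv.swap_apply_right, id]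
      rfl
    · have : Equiv.swap (0 : Fin (n + 2)) 1 i.succ.succ = i.succ.succ :=
        Equiv.swap_apply_of_ne_of_ne (Fin.succ_ne_zero _)
          (by rw [← Fin.succ_zero_eq_one]; exact fun h => Fin.succ_ne_zero _ (Fin.succ_injective _ h))
      simp [this]
  rw [h2] at this
  simpa using this

theorem skewMinors_swap (φ : Matrix (Fin n) (Fin (n + 2)) R) (j k : Fin (n + 2)) :
    skewMinors φ k j = - skewMinors φ j k :=
  det_consRow_swap φ _ _

theorem skewMinors_mulVec (φ : Matrix (Fin n) (Fin (n + 2)) R) (v : Fin (n + 2) → R)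
    (j : Fin (n + 2)) :
    (skewMinors φ *ᵥ v) j = (consRow (Pi.single j 1) (consRow v φ)).det := by
  have h : ∀ w, consRow (Pi.single j 1) (consRow w φ) =
    (consRow (Pi.single j 1) (consRow 0 φ)).updateRow (Fin.succ 0) w := fun w => by
    rw [updateRow_consRow_succ, updateRow_consRow_zero]
  rw [h, det_updateRow_eq_sum]
  simp_rw [← h]
  rfl

theorem skewMinors_mul_transpose (φ : Matrix (Fin n) (Fin (n + 2)) R) :
    skewMinors φ * φᵀ = 0 := by
  ext j i
  change (skewMinors φ *ᵥ (φ i)) j = 0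
  rw [skewMinors_mulVec]
  refine det_zero_of_row_eq (i := Fin.succ 0) (j := i.succ.succ) ?_ rfl
  exact fun h => Fin.succ_ne_zero _ (Fin.succ_injective _ h).symm

theorem mul_skewMinors (φ : Matrix (Fin n) (Fin (n + 2)) R) : φ * skewMinors φ = 0 := by
  have h : (skewMinors φ)ᵀ = - skewMinors φ := by
    ext j k; exact skewMinors_swap φ j k
  have := congrArg transpose (skewMinors_mul_transpose φ)
  rw [transpose_mul, transpose_transpose, h] at this
  simpa using this

theorem skewMinors_smul_mem_range_transpose (φ : Matrix (Fin n) (Fin (n + 2)) R)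
    (j k : Fin (n + 2)) {v : Fin (n + 2) → R} (hv : skewMinors φ *ᵥ v = 0) :
    skewMinors φ j k • v ∈ LinearMap.range φᵀ.mulVecLin := by
  have h := det_smul_eq_sum (consRow (Pi.single j 1) (consRow (Pi.single k 1) φ)) v
  have hl : ∀ l, (consRow (Pi.single l 1) (consRow v φ)).det = 0 := fun l => by
    rw [← skewMinors_mulVec, hv]; rfl
  rw [Fin.sum_univ_succ, Fin.sum_univ_succ, updateRow_consRow_zero, updateRow_consRow_succ,
    updateRow_consRow_zero, hl, det_consRow_swap φ (Pi.single k 1) v, hl, neg_zero, zero_smul, zero_smul,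
    zero_add, zero_add, ← skewMinors_apply] at h
  rw [h]
  exact Submodule.sum_mem _ fun i _ => Submodule.smul_mem _ _
    ⟨Pi.single i 1, by ext l; simp⟩

theorem skewMinors_smul_mem_range_skewMinors (φ : Matrix (Fin n) (Fin (n + 2)) R)
    (j k : Fin (n + 2)) {v : Fin (n + 2) → R} (hv : φ *ᵥ v = 0) :
    skewMinors φ j k • v ∈ LinearMap.range (skewMinors φ).mulVecLin := by
  refine ⟨v j • Pi.single k 1 - v k • Pi.single j 1, ?_⟩
  ext l
  have h := det_smul_eq_sum_adjugate (consRow (Pi.single j 1) (consRow (Pi.single k 1) φ)) v l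
  rw [Fin.sum_univ_succ, Fin.sum_univ_succ, updateRow_consRow_zero, updateRow_consRow_succ,
    updateRow_consRow_zero] at h
  simp only [consRow_mulVec_succ, consRow_mulVec_zero, hv, ← skewMinors_apply, Pi.zero_apply,
    mul_zero, Finset.sum_const_zero, add_zero, single_one_dotProduct] at h
  rw [Pi.smul_apply, smul_eq_mul, h, skewMinors_swap φ l j]
  simp [mulVec_sub, mulVec_smul]
  ring

theorem skewMinors_smul_mem_range (φ : Matrix (Fin n) (Fin (n + 2)) R)
    (j k : Fin (n + 2)) (v : Fin n → R) :
    skewMinors φ j k • v ∈ LinearMap.range φ.mulVecLin := by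
  have h := mulVec_cramer (consRow (Pi.single j 1) (consRow (Pi.single k 1) φ))
    (Fin.cons 0 (Fin.cons 0 v))
  exact ⟨_, funext fun i => congrFun h i.succ.succ⟩

end Complex

section Exactness

variable {R : Type*} [CommRing R] {n : ℕ}

theorem smul_mem_of_mem_span {M : Type*} [AddCommGroup M] [Module R M] {s : Set R}
    {N : Submodule R M} {v : M} (h : ∀ r ∈ s, r • v ∈ N) {f : R} (hf : f ∈ Ideal.span s) :
    f • v ∈ N :=
  (Ideal.span_le.2 h : Ideal.span s ≤ N.comap (LinearMap.toSpanSingleton R M v)) hf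

/-- The ideal of maximal minors of an `n × (n + 2)` matrix, up to sign. -/
def skewMinorsIdeal (φ : Matrix (Fin n) (Fin (n + 2)) R) : Ideal R :=
  Ideal.span (Set.range fun p : Fin (n + 2) × Fin (n + 2) => skewMinors φ p.1 p.2)

theorem smul_mem_range_of_mem_skewMinorsIdeal (φ : Matrix (Fin n) (Fin (n + 2)) R) {f : R}
    (hf : f ∈ skewMinorsIdeal φ) (v : Fin n → R) : f • v ∈ LinearMap.range φ.mulVecLin :=
  smul_mem_of_mem_span (by rintro _ ⟨p, rfl⟩; exact skewMinors_smul_mem_range φ _ _ v) hf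

theorem ker_transpose_mulVecLin_eq_bot [IsDomain R]
    (φ : Matrix (Fin n) (Fin (n + 2)) R) {f : R}
    (hf : f ∈ skewMinorsIdeal φ) (hf0 : f ≠ 0) : LinearMap.ker φᵀ.mulVecLin = ⊥ := by
  rw [LinearMap.ker_eq_bot']
  intro v hv
  ext i
  obtain ⟨w, hw⟩ := smul_mem_range_of_mem_skewMinorsIdeal φ hf (Pi.single i 1)
  have h1 : v ⬝ᵥ (φ *ᵥ w) = 0 := by
    rw [dotProduct_mulVec, ← mulVec_transpose, show φᵀ *ᵥ v = 0 from hv, zero_dotProduct]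
  rw [show φ *ᵥ w = _ from hw, dotProduct_smul, dotProduct_single_one] at h1
  exact (mul_eq_zero.1 h1).resolve_left hf0

theorem ker_skewMinors_eq_range [IsDomain R]
    (φ : Matrix (Fin n) (Fin (n + 2)) R) {f g h : R}
    (H : IsKoszulRegular f g h) (hf : f ∈ skewMinorsIdeal φ) (hg : g ∈ skewMinorsIdeal φ) :
    LinearMap.ker (skewMinors φ).mulVecLin = LinearMap.range φᵀ.mulVecLin := by
  apply le_antisymm
  · intro v hv
    have key : ∀ {r}, r ∈ skewMinorsIdeal φ → r • v ∈ LinearMap.range φᵀ.mulVecLin :=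
      smul_mem_of_mem_span (by
        rintro _ ⟨p, rfl⟩; exact skewMinors_smul_mem_range_transpose φ _ _ hv)
    exact mem_range_of_smul_mem_range_of_injective H _
      (LinearMap.ker_eq_bot.1 (ker_transpose_mulVecLin_eq_bot φ hf H.ne_zero)) (key hf) (key hg)
  · rintro _ ⟨w, rfl⟩
    rw [LinearMap.mem_ker, mulVecLin_apply, mulVecLin_apply, mulVec_mulVec,
      skewMinors_mul_transpose, zero_mulVec]

theorem ker_mulVecLin_eq_range_skewMinors [IsDomain R]
    (φ : Matrix (Fin n) (Fin (n + 2)) R) {f g h : R}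
    (H : IsKoszulRegular f g h) (hf : f ∈ skewMinorsIdeal φ) (hg : g ∈ skewMinorsIdeal φ)
    (hh : h ∈ skewMinorsIdeal φ) :
    LinearMap.ker φ.mulVecLin = LinearMap.range (skewMinors φ).mulVecLin := by
  apply le_antisymm
  · intro v hv
    have key : ∀ {r}, r ∈ skewMinorsIdeal φ → r • v ∈ LinearMap.range (skewMinors φ).mulVecLin :=
      smul_mem_of_mem_span (by
        rintro _ ⟨p, rfl⟩; exact skewMinors_smul_mem_range_skewMinors φ _ _ hv)
    exact mem_range_of_smul_mem_range_of_exact H _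
      (LinearMap.ker_eq_bot.1 (ker_transpose_mulVecLin_eq_bot φ hf H.ne_zero)) _
      (ker_skewMinors_eq_range φ H hf hg) (key hf) (key hg) (key hh)
  · rintro _ ⟨w, rfl⟩
    simp [mulVec_mulVec, mul_skewMinors]

theorem pow_mul_eq_det_mul_det {k : ℕ} (ψ : Matrix (Fin k) (Fin (k + 1)) R) (f : R)
    (W : Matrix (Fin k) (Fin (k + 1)) R) (hW : ∀ i, ψ *ᵥ W i = f • Pi.single i 1)
    {v : Fin (k + 1) → R} (hv : ψ *ᵥ v = 0) (l : Fin (k + 1)) :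
    f ^ k * v l = (consRow v W).det * (consRow (Pi.single l 1) ψ).det := by
  have h0 : ∀ i, (consRow (Pi.single l 1) ψ * (consRow v W)ᵀ) i 0 =
      (consRow (Pi.single l 1) ψ *ᵥ v) i := fun i => rfl
  have h1 : (consRow (Pi.single l 1) ψ * (consRow v W)ᵀ).submatrix Fin.succ Fin.succ =
      f • (1 : Matrix (Fin k) (Fin k) R) := by
    ext i j
    refine (congrFun (hW j) i).trans ?_
    simp [Matrix.one_apply, Pi.single_apply]
  have h2 : (consRow (Pi.single l 1) ψ * (consRow v W)ᵀ).det = v l * f ^ k := by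
    rw [det_succ_column_zero, Fin.sum_univ_succ]
    simp only [h0, consRow_mulVec_zero, consRow_mulVec_succ, hv]
    simp [h1, Fin.succAbove_zero]
  rw [mul_comm, ← h2, det_mul, det_transpose, mul_comm]

/-- A `k × (k + 1)` matrix whose cokernel is annihilated by powers of three independent
elements is surjective. -/
theorem mem_range_of_smul_mem_range [IsDomain R] {k : ℕ}
    (ψ : Matrix (Fin k) (Fin (k + 1)) R) {f g h : R}
    (H : IsKoszulRegular f g h) (Hk : IsKoszulRegular (f ^ k) (g ^ k) (h ^ k))
    (hf : ∀ v, f • v ∈ LinearMap.range ψ.mulVecLin)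
    (hg : ∀ v, g • v ∈ LinearMap.range ψ.mulVecLin)
    (hh : ∀ v, h • v ∈ LinearMap.range ψ.mulVecLin) (v : Fin k → R) :
    v ∈ LinearMap.range ψ.mulVecLin := by
  choose F hF using fun i => hf (Pi.single i 1)
  choose G hG using fun i => hg (Pi.single i 1)
  set m : Fin (k + 1) → R := fun l => (consRow (Pi.single l 1) ψ).det with hm
  have hmf : ∀ {v}, ψ *ᵥ v = 0 → f ^ k • v = (consRow v F).det • m := fun hv =>
    funext (pow_mul_eq_det_mul_det ψ f F hF hv)
  have hmg : ∀ {v}, ψ *ᵥ v = 0 → g ^ k • v = (consRow v G).det • m := fun hv =>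
    funext (pow_mul_eq_det_mul_det ψ g G hG hv)
  have hm0 : m ≠ 0 := by
    intro hm0
    have hinj : Function.Injective ψ.mulVecLin := by
      rw [← LinearMap.ker_eq_bot, LinearMap.ker_eq_bot']
      intro v hv
      have := hmf hv
      rw [hm0, smul_zero] at this
      exact (smul_eq_zero.1 this).resolve_left Hk.ne_zero
    have := card_le_of_injective R _ hinj
    simp at this
  have hψm : ψ *ᵥ m = 0 := by
    ext i
    have h1 := det_updateRow_eq_sum (consRow 0 ψ) 0 (ψ i)
    simp only [updateRow_consRow_zero] at h1
    rw [det_zero_of_row_eq (Fin.succ_ne_zero i).symm (by simp)] at h1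
    rw [Pi.zero_apply, h1]
    simp only [mulVec, dotProduct, hm]
    exact Finset.sum_congr rfl fun l _ => mul_comm _ _
  let D : (Unit → R) →ₗ[R] (Fin (k + 1) → R) :=
    (LinearMap.toSpanSingleton R _ m).comp (LinearMap.proj ())
  have hD : ∀ p, D p = p () • m := fun p => rfl
  refine mem_range_of_smul_mem_range_of_exact H D ?_ ψ.mulVecLin ?_ (hf v) (hg v) (hh v)
  · intro p q hpq
    rw [hD, hD] at hpq
    exact funext fun _ => smul_left_injective R hm0 hpq
  · apply le_antisymm
    · intro v hv
      have h1 := hmf hv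
      have h2 := hmg hv
      have h3 : (g ^ k * (consRow v F).det) • m = (f ^ k * (consRow v G).det) • m := by
        rw [mul_smul, mul_smul, ← h1, ← h2, smul_comm]
      obtain ⟨c, hc⟩ := Hk.dvd_of_mul_eq_mul _ _ (smul_left_injective R hm0 h3)
      refine ⟨fun _ => c, smul_right_injective _ Hk.ne_zero ?_⟩
      change f ^ k • c • m = f ^ k • v
      rw [h1, hc, mul_smul]
    · rintro _ ⟨p, rfl⟩
      rw [LinearMap.mem_ker, hD, map_smul]
      simp [hψm]

end Exactness

section Polynomial

variable {K : Type*} [Field K]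

theorem MvPolynomial.X_pow_dvd_of_mul_eq_mul {σ : Type*} {i j : σ} (hij : i ≠ j) (N : ℕ)
    (p q : MvPolynomial σ K) (h : X j ^ N * p = X i ^ N * q) : (X i ^ N : MvPolynomial σ K) ∣ p := by
  have hp : Prime (X i : MvPolynomial σ K) := X_prime
  refine hp.pow_dvd_of_dvd_mul_left N (fun hd => hij ?_) (Dvd.intro _ h.symm)
  have := hp.dvd_of_dvd_pow hd
  rwa [X_dvd_X] at this

theorem MvPolynomial.mem_span_pair_of_X_pow_mul_mem {σ : Type*} {i j k : σ} (hik : i ≠ k)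
    (hjk : j ≠ k) (N : ℕ) (u : MvPolynomial σ K)
    (h : X k ^ N * u ∈ Ideal.span {(X i ^ N : MvPolynomial σ K), X j ^ N}) :
    u ∈ Ideal.span {(X i ^ N : MvPolynomial σ K), X j ^ N} := by
  classical
  have e : Ideal.span {(X i ^ N : MvPolynomial σ K), X j ^ N} =
      Ideal.span ((fun s => monomial s (1 : K)) '' {Finsupp.single i N, Finsupp.single j N}) := by
    rw [Set.image_pair, X_pow_eq_monomial, X_pow_eq_monomial]
  rw [e, mem_ideal_span_monomial_image] at h ⊢
  intro x hx
  obtain ⟨s, hs, hsx⟩ := h (Finsupp.single k N + x) (by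
    rw [mem_support_iff, X_pow_eq_monomial, coeff_monomial_mul, one_mul]
    exact mem_support_iff.1 hx)
  refine ⟨s, hs, ?_⟩
  rcases hs with rfl | rfl
  · rw [Finsupp.single_le_iff] at hsx ⊢
    simpa [Finsupp.single_apply, hik.symm] using hsx
  · rw [Finsupp.single_le_iff] at hsx ⊢
    simpa [Finsupp.single_apply, hjk.symm] using hsx

theorem isKoszulRegular_X_pow (N : ℕ) :
    IsKoszulRegular (X 0 ^ N : MvPolynomial (Fin 3) K) (X 1 ^ N) (X 2 ^ N) where
  ne_zero := pow_ne_zero _ (X_ne_zero _)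
  dvd_of_mul_eq_mul := X_pow_dvd_of_mul_eq_mul (by decide) N
  exists_of_mul_eq u p q h := by
    have := mem_span_pair_of_X_pow_mul_mem (i := (0 : Fin 3)) (j := 1) (k := 2) (by decide)
      (by decide) N u (h ▸ sub_mem (Ideal.mul_mem_right _ _ (Ideal.subset_span (by simp)))
        (Ideal.mul_mem_right _ _ (Ideal.subset_span (by simp))))
    obtain ⟨r, s, hrs⟩ := Ideal.mem_span_pair.1 this
    exact ⟨s, -r, by rw [← hrs]; ring⟩

theorem mem_hcomp_of_isHomogeneous {r : ℕ} {z : ℤ} (hz : 0 ≤ z) {f : MvPolynomial (Fin r) K} :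
    f ∈ hcomp K r z ↔ f.IsHomogeneous z.toNat := by
  rw [hcomp, if_pos hz, mem_homogeneousSubmodule]

theorem hcomp_of_neg {r : ℕ} {z : ℤ} (hz : z < 0) : hcomp K r z = ⊥ := by
  rw [hcomp, if_neg (by omega)]

/-- The homogeneous component of integer degree `z` of a polynomial. -/
noncomputable def hproj (K : Type*) [Field K] (r : ℕ) (z : ℤ) :
    MvPolynomial (Fin r) K →ₗ[K] MvPolynomial (Fin r) K :=
  if 0 ≤ z then homogeneousComponent z.toNat else 0

theorem hproj_mem {r : ℕ} (z : ℤ) (f : MvPolynomial (Fin r) K) : hproj K r z f ∈ hcomp K r z := by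
  by_cases hz : 0 ≤ z
  · rw [mem_hcomp_of_isHomogeneous hz, hproj, if_pos hz]
    exact homogeneousComponent_isHomogeneous _ _
  · simp [hproj, hz]

theorem hproj_of_mem {r : ℕ} {z : ℤ} {f : MvPolynomial (Fin r) K} (hf : f ∈ hcomp K r z) :
    hproj K r z f = f := by
  by_cases hz : 0 ≤ z
  · rw [mem_hcomp_of_isHomogeneous hz] at hf
    rw [hproj, if_pos hz, homogeneousComponent_eq_self hf]
  · rw [hcomp_of_neg (by omega), Submodule.mem_bot] at hf
    simp [hf]

theorem mul_mem_hcomp {r : ℕ} {z w : ℤ} {f g : MvPolynomial (Fin r) K} (hf : f ∈ hcomp K r z)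
    (hg : g ∈ hcomp K r w) : f * g ∈ hcomp K r (z + w) := by
  by_cases hz : 0 ≤ z
  · by_cases hw : 0 ≤ w
    · rw [mem_hcomp_of_isHomogeneous hz] at hf
      rw [mem_hcomp_of_isHomogeneous hw] at hg
      rw [mem_hcomp_of_isHomogeneous (by omega), Int.toNat_add hz hw]
      exact hf.mul hg
    · rw [hcomp_of_neg (by omega), Submodule.mem_bot] at hg
      simp [hg]
  · rw [hcomp_of_neg (by omega), Submodule.mem_bot] at hf
    simp [hf]

theorem one_mem_hcomp {r : ℕ} : (1 : MvPolynomial (Fin r) K) ∈ hcomp K r 0 :=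
  (mem_hcomp_of_isHomogeneous le_rfl).2 (isHomogeneous_one _ _)

theorem prod_mem_hcomp {r : ℕ} {ι : Type*} (s : Finset ι) (z : ι → ℤ)
    (f : ι → MvPolynomial (Fin r) K) (h : ∀ i ∈ s, f i ∈ hcomp K r (z i)) :
    ∏ i ∈ s, f i ∈ hcomp K r (∑ i ∈ s, z i) := by
  classical
  induction s using Finset.induction_on with
  | empty => simpa using one_mem_hcomp
  | insert i s hi ih =>
    rw [Finset.prod_insert hi, Finset.sum_insert hi]
    exact mul_mem_hcomp (h i (by simp)) (ih fun j hj => h j (by simp [hj]))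

theorem hproj_mul {r : ℕ} {z w : ℤ} {f : MvPolynomial (Fin r) K} (hf : f ∈ hcomp K r z)
    (g : MvPolynomial (Fin r) K) : hproj K r (z + w) (f * g) = f * hproj K r w g := by
  by_cases hz : 0 ≤ z
  · rw [mem_hcomp_of_isHomogeneous hz] at hf
    have key : ∀ m : ℕ, homogeneousComponent m (f * g) =
        if z.toNat ≤ m then f * homogeneousComponent (m - z.toNat) g else 0 := by
      intro m
      conv_lhs => rw [← sum_homogeneousComponent g, Finset.mul_sum, map_sum]
      have h1 : ∀ i, homogeneousComponent m (f * homogeneousComponent i g) =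
          if z.toNat + i = m then f * homogeneousComponent i g else 0 := fun i => by
        rw [homogeneousComponent_of_mem (m := m) (n := z.toNat + i)]
        · simp [eq_comm]
        · exact hf.mul (homogeneousComponent_isHomogeneous _ _)
      simp_rw [h1]
      split_ifs with hm
      · rw [Finset.sum_eq_single (m - z.toNat)]
        · rw [if_pos (by omega)]
        · intro i _ hi
          rw [if_neg (by omega)]
        · intro hi
          rw [if_pos (by omega), homogeneousComponent_eq_zero, mul_zero]
          simp only [Finset.mem_range] at hi
          omega
      · exact Finset.sum_eq_zero fun i _ => if_neg (by omega)
    by_cases hw : 0 ≤ w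
    · rw [hproj, hproj, if_pos hw, if_pos (by omega), key, if_pos (by omega)]
      congr 3
      omega
    · rw [hproj, hproj, if_neg hw, LinearMap.zero_apply, mul_zero]
      split_ifs
      · rw [key, if_neg (by omega)]
      · rfl
  · rw [hcomp_of_neg (by omega), Submodule.mem_bot] at hf
    simp [hf]

theorem det_mem_hcomp {r : ℕ} {ι : Type*} [Fintype ι] [DecidableEq ι]
    (A : Matrix ι ι (MvPolynomial (Fin r) K)) (v w : ι → ℤ)
    (hA : ∀ i j, A i j ∈ hcomp K r (v j - w i)) : A.det ∈ hcomp K r (∑ j, v j - ∑ i, w i) := by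
  rw [det_apply]
  refine Submodule.sum_mem _ fun σ _ => ?_
  rw [Units.smul_def]
  refine zsmul_mem ?_ _
  have h := prod_mem_hcomp Finset.univ (fun i => v i - w (σ i)) (fun i => A (σ i) i)
    fun i _ => hA _ _
  rwa [Finset.sum_sub_distrib, Equiv.sum_comp σ w] at h

end Polynomial

section Height

variable {K : Type*} [Field K]

attribute [local instance] MvPolynomial.gradedAlgebra

theorem isHomogeneousElem_of_mem_hcomp {r : ℕ} {z : ℤ} {f : MvPolynomial (Fin r) K}
    (hf : f ∈ hcomp K r z) : SetLike.IsHomogeneousElem (homogeneousSubmodule (Fin r) K) f := by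
  by_cases hz : 0 ≤ z
  · exact ⟨_, (mem_hcomp_of_isHomogeneous hz).1 hf⟩
  · rw [hcomp_of_neg (by omega), Submodule.mem_bot] at hf
    exact hf ▸ ⟨0, zero_mem _⟩

theorem constantCoeff_eq_zero_of_mem {σ : Type*} {J : Ideal (MvPolynomial σ K)}
    (hJ : J.IsHomogeneous (homogeneousSubmodule σ K)) (hJ1 : J ≠ ⊤) {f : MvPolynomial σ K}
    (hf : f ∈ J) : constantCoeff f = 0 := by
  by_contra h
  have := homogeneousComponent_mem_of_mem hJ hf 0
  rw [homogeneousComponent_zero] at this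
  exact hJ1 (Ideal.eq_top_of_isUnit_mem _ this ((Ne.isUnit h).map C))

theorem X_mem_radical_of_isHomogeneous {σ : Type*} {J : Ideal (MvPolynomial σ K)}
    (hJ : J.IsHomogeneous (homogeneousSubmodule σ K))
    (hmax : ∀ P : Ideal (MvPolynomial σ K), P.IsPrime → J ≤ P → P.IsMaximal) (i : σ) :
    X i ∈ J.radical := by
  rw [Ideal.radical_eq_sInf, Ideal.mem_sInf]
  rintro P ⟨hJP, hP⟩
  set Q := P.homogeneousCore (homogeneousSubmodule σ K) with hQ
  have hQP : Q.toIdeal ≤ P := Ideal.toIdeal_homogeneousCore_le _ _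
  have hQprime : Q.toIdeal.IsPrime := hP.homogeneousCore
  have hJQ : J ≤ Q.toIdeal := by
    have := Ideal.homogeneousCore_mono (homogeneousSubmodule σ K) hJP
    rw [← hJ.toIdeal_homogeneousCore_eq_self]
    exact this
  have hker : Q.toIdeal = RingHom.ker (constantCoeff (σ := σ) (R := K)) :=
    (hmax _ hQprime hJQ).eq_of_le (RingHom.ker_ne_top _) fun f hf =>
      constantCoeff_eq_zero_of_mem Q.isHomogeneous hQprime.ne_top hf
  exact hQP (hker ▸ MvPolynomial.constantCoeff_X (R := K) i)

theorem isMaximal_of_idealHeight_eq {r : ℕ} {J P : Ideal (MvPolynomial (Fin r) K)}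
    (hJ : idealHeight J = r) (hP : P.IsPrime) (hJP : J ≤ P) : P.IsMaximal := by
  by_contra hmax
  obtain ⟨m, hm, hPm⟩ := Ideal.exists_le_maximal P hP.ne_top
  have hlt : (⟨P, hP⟩ : PrimeSpectrum (MvPolynomial (Fin r) K)) < ⟨m, hm.isPrime⟩ :=
    lt_of_le_of_ne hPm fun h => hmax (by
      have : P = m := congrArg PrimeSpectrum.asIdeal h
      exact this ▸ hm)
  have h1 : (r : ℕ∞) ≤ Order.height (⟨P, hP⟩ : PrimeSpectrum (MvPolynomial (Fin r) K)) :=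
    
    hJ ▸ iInf₂_le (f := fun p (_ : J ≤ PrimeSpectrum.asIdeal p) => Order.height p) ⟨P, hP⟩ hJP
  have h2 := (add_le_add_left h1 1).trans (Order.height_add_one_le hlt)
  have h3 := Order.height_le_krullDim
    (⟨m, hm.isPrime⟩ : PrimeSpectrum (MvPolynomial (Fin r) K))
  have h4 : Order.krullDim (PrimeSpectrum (MvPolynomial (Fin r) K)) = ((r : ℕ∞) : WithBot ℕ∞) := by
    have := MvPolynomial.ringKrullDim_of_isNoetherianRing (R := K) (ι := Fin r)
    rw [ringKrullDim_eq_zero_of_field, zero_add, Nat.card_fin] at this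
    exact this
  rw [h4, WithBot.coe_le_coe] at h3
  have := h2.trans h3
  norm_cast at this
  omega

theorem exists_X_pow_mem {r : ℕ} {J : Ideal (MvPolynomial (Fin r) K)}
    (hJ : J.IsHomogeneous (homogeneousSubmodule (Fin r) K)) (hJr : idealHeight J = r) :
    ∃ N : ℕ, ∀ i, (X i : MvPolynomial (Fin r) K) ^ N ∈ J := by
  choose e he using fun i => X_mem_radical_of_isHomogeneous hJ
    (fun P hP hJP => isMaximal_of_idealHeight_eq hJr hP hJP) i
  exact ⟨∑ i, e i, fun i => J.pow_mem_of_pow_mem (he i)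
    (Finset.single_le_sum (fun _ _ => Nat.zero_le _) (Finset.mem_univ i))⟩

theorem isHomogeneous_span_minors {n m r : ℕ} (φ : Matrix (Fin n) (Fin m) (MvPolynomial (Fin r) K))
    (a : Fin n → ℤ) (b : Fin m → ℤ) (hφ : ∀ i j, φ i j ∈ hcomp K r (b j - a i)) :
    (Ideal.span {f | ∃ g : Fin n → Fin m, Function.Injective g ∧
      f = (φ.submatrix id g).det}).IsHomogeneous (homogeneousSubmodule (Fin r) K) := by
  refine Ideal.homogeneous_span _ _ ?_
  rintro _ ⟨g, -, rfl⟩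
  exact isHomogeneousElem_of_mem_hcomp (det_mem_hcomp _ (b ∘ g) a fun i j => hφ i (g j))

theorem skewMinors_mem_hcomp {n r : ℕ}
    (φ : Matrix (Fin n) (Fin (n + 2)) (MvPolynomial (Fin r) K))
    (a : Fin n → ℤ) (b : Fin (n + 2) → ℤ) (hφ : ∀ i j, φ i j ∈ hcomp K r (b j - a i))
    (j k : Fin (n + 2)) :
    skewMinors φ j k ∈ hcomp K r (∑ j, b j - ∑ i, a i - b k - b j) := by
  have hs : ∀ j l, (Pi.single j 1 : Fin (n + 2) → MvPolynomial (Fin r) K) l ∈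
      hcomp K r (b l - b j) := fun j l => by
    rcases eq_or_ne l j with rfl | h
    · simpa using one_mem_hcomp
    · simp [h]
  have := det_mem_hcomp (consRow (Pi.single j 1) (consRow (Pi.single k 1) φ)) b
    (Fin.cons (b j) (Fin.cons (b k) a)) fun i l => by
      refine Fin.cases (hs j l) (fun i => Fin.cases (hs k l) (fun i => hφ i l) i) i
  rw [Fin.sum_cons, Fin.sum_cons] at this
  rw [skewMinors_apply, show ∑ j, b j - ∑ i, a i - b k - b j =
    ∑ j, b j - (b j + (b k + ∑ i, a i)) by ring]
  exact this

end Height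

section Degree

variable {K : Type*} [Field K]

theorem constantCoeff_eq_zero_of_mem_hcomp {r : ℕ} {z : ℤ} (hz : z ≠ 0)
    {f : MvPolynomial (Fin r) K} (hf : f ∈ hcomp K r z) : constantCoeff f = 0 := by
  by_cases h : 0 ≤ z
  · rw [mem_hcomp_of_isHomogeneous h] at hf
    exact hf.coeff_eq_zero (by simp; omega)
  · rw [hcomp_of_neg (by omega), Submodule.mem_bot] at hf
    simp [hf]

theorem diagonal_degree_pos {n : ℕ} {a : Fin n → ℤ} {b : Fin (n + 2) → ℤ}
    (ha : Monotone a) (hb : Monotone b)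
    (φ : Matrix (Fin n) (Fin (n + 2)) (MvPolynomial (Fin 3) K))
    (hφ : ∀ i j, φ i j ∈ hcomp K 3 (b j - a i)) (hφ0 : ∀ i j, b j ≤ a i → φ i j = 0)
    {N : ℕ} (hN : ∀ i, (X i : MvPolynomial (Fin 3) K) ^ N ∈ skewMinorsIdeal φ)
    (i₀ : Fin n) : a i₀ < b (Fin.castLE (by omega) i₀) := by
  by_contra! hle
  have hconst : ∀ i j, constantCoeff (φ i j) = 0 := fun i j => by
    rcases le_or_gt (b j) (a i) with h | h
    · rw [hφ0 i j h, map_zero]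
    · exact constantCoeff_eq_zero_of_mem_hcomp (by omega) (hφ i j)
  obtain ⟨k, hk⟩ : ∃ k, n = i₀ + k := ⟨n - i₀, by omega⟩
  let ρ : Fin k → Fin n := fun i => ⟨i₀ + i, by omega⟩
  let κ : Fin (k + 1) → Fin (n + 2) := fun j => ⟨i₀ + 1 + j, by omega⟩
  have hρ : Function.Injective ρ := fun i j h => by
    have := congrArg Fin.val h
    simp only [ρ] at this
    omega
  have hκ : Function.Injective κ := fun i j h => by
    have := congrArg Fin.val h
    simp only [κ] at this
    omega
  have hzero : ∀ i j, j ∉ Set.range κ → φ (ρ i) j = 0 := by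
    intro i j hj
    rcases le_or_gt (j : ℕ) i₀ with h | h
    · refine hφ0 _ _ ((hb ?_).trans (hle.trans (ha ?_)))
      · simpa [Fin.le_def] using h
      · simp [ρ, Fin.le_def]
    · rcases lt_or_ge (j : ℕ) (i₀ + 1 + (k + 1)) with h' | h'
      · exact absurd ⟨⟨j - (i₀ + 1), by omega⟩, Fin.ext (by simp only [κ]; omega)⟩ hj
      · omega
  have key : ∀ f ∈ skewMinorsIdeal φ, ∀ v : Fin k → MvPolynomial (Fin 3) K,
      f • v ∈ LinearMap.range (φ.submatrix ρ κ).mulVecLin := by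
    intro f hf v
    obtain ⟨w, hw⟩ := smul_mem_range_of_mem_skewMinorsIdeal φ hf (Function.extend ρ v 0)
    refine ⟨w ∘ κ, funext fun i => ?_⟩
    have h1 := congrFun hw (ρ i)
    rw [Pi.smul_apply, hρ.extend_apply] at h1
    rw [Pi.smul_apply, ← h1]
    exact Fintype.sum_of_injective κ hκ _ _
      (fun j hj => mul_eq_zero_of_left (hzero i j hj) _) (fun _ => rfl)
  have hsurj := mem_range_of_smul_mem_range (φ.submatrix ρ κ) (isKoszulRegular_X_pow N)
    (by simp only [← pow_mul]; exact isKoszulRegular_X_pow (N * k))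
    (key _ (hN 0)) (key _ (hN 1)) (key _ (hN 2))
  obtain ⟨w, hw⟩ := hsurj fun _ => 1
  have h0 := congrArg constantCoeff (congrFun hw ⟨0, by omega⟩)
  rw [mulVecLin_apply, mulVec, dotProduct, map_sum, map_one] at h0
  simp [hconst] at h0

/-- The degree-`t` piece of the graded free module `⊕ R(-w i)`. -/
noncomputable def freePiece (K : Type*) [Field K] (r : ℕ) {ι : Type*} (w : ι → ℤ) (t : ℤ) :
    Submodule K (ι → MvPolynomial (Fin r) K) :=
  Submodule.pi Set.univ fun i => hcomp K r (t - w i)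

theorem mem_freePiece {r : ℕ} {ι : Type*} {w : ι → ℤ} {t : ℤ} {f : ι → MvPolynomial (Fin r) K} :
    f ∈ freePiece K r w t ↔ ∀ i, f i ∈ hcomp K r (t - w i) := by
  simp [freePiece, Submodule.mem_pi]

instance {r : ℕ} {z : ℤ} : Module.Finite K (hcomp K r z) := by
  by_cases hz : 0 ≤ z
  · rw [hcomp, if_pos hz]
    exact Module.Finite.iff_fg.2 (homogeneousSubmodule_fg _ _ _)
  · rw [hcomp_of_neg (by omega)]
    infer_instance

/-- A graded piece of a graded free module is the product of graded pieces of the ring. -/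
noncomputable def freePieceEquiv (K : Type*) [Field K] (r : ℕ) {ι : Type*} (w : ι → ℤ) (t : ℤ) :
    freePiece K r w t ≃ₗ[K] ∀ i, hcomp K r (t - w i) where
  toFun f i := ⟨f.1 i, f.2 i trivial⟩
  invFun g := ⟨fun i => g i, fun i _ => (g i).2⟩
  left_inv _ := rfl
  right_inv _ := rfl
  map_add' _ _ := rfl
  map_smul' _ _ := rfl

instance {r : ℕ} {ι : Type*} [Finite ι] {w : ι → ℤ} {t : ℤ} :
    Module.Finite K (freePiece K r w t) :=
  Module.Finite.equiv (freePieceEquiv K r w t).symm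

theorem finrank_freePiece {r : ℕ} {ι : Type*} [Fintype ι] (w : ι → ℤ) (t : ℤ) :
    Module.finrank K (freePiece K r w t) = ∑ i, Module.finrank K (hcomp K r (t - w i)) := by
  rw [(freePieceEquiv K r w t).finrank_eq, Module.finrank_pi_fintype]

theorem mulVec_mem_freePiece {r : ℕ} {ι κ : Type*} [Fintype κ] {w : ι → ℤ} {v : κ → ℤ}
    {A : Matrix ι κ (MvPolynomial (Fin r) K)} (hA : ∀ i j, A i j ∈ hcomp K r (v j - w i)) {t : ℤ}
    {u : κ → MvPolynomial (Fin r) K} (hu : u ∈ freePiece K r v t) :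
    A *ᵥ u ∈ freePiece K r w t := by
  rw [mem_freePiece] at hu ⊢
  intro i
  refine Submodule.sum_mem _ fun j _ => ?_
  have := mul_mem_hcomp (hA i j) (hu j)
  rwa [show v j - w i + (t - v j) = t - w i by ring] at this

theorem exists_freePiece_mulVec_eq {r : ℕ} {ι κ : Type*} [Fintype κ] {w : ι → ℤ} {v : κ → ℤ}
    {A : Matrix ι κ (MvPolynomial (Fin r) K)} (hA : ∀ i j, A i j ∈ hcomp K r (v j - w i)) {t : ℤ}
    {u : κ → MvPolynomial (Fin r) K} (hu : A *ᵥ u ∈ freePiece K r w t) :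
    ∃ u' ∈ freePiece K r v t, A *ᵥ u' = A *ᵥ u := by
  refine ⟨fun j => hproj K r (t - v j) (u j), mem_freePiece.2 fun j => hproj_mem _ _, ?_⟩
  ext1 i
  rw [← hproj_of_mem (mem_freePiece.1 hu i), mulVec, mulVec, dotProduct, dotProduct, map_sum]
  refine Finset.sum_congr rfl fun j _ => ?_
  rw [← hproj_mul (hA i j), show v j - w i + (t - v j) = t - w i by ring]

theorem Submodule.finrank_map_add_finrank_inf_ker {V W : Type*} [AddCommGroup V] [Module K V]
    [AddCommGroup W] [Module K W] (f : V →ₗ[K] W) (P : Submodule K V) [Module.Finite K P] :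
    Module.finrank K (P.map f) + Module.finrank K (P ⊓ LinearMap.ker f : Submodule K V) =
      Module.finrank K P := by
  rw [← LinearMap.finrank_range_add_finrank_ker (f.domRestrict P), LinearMap.range_domRestrict,
    LinearMap.ker_domRestrict, ← Submodule.finrank_map_subtype_eq, Submodule.map_comap_subtype]

theorem finrank_map_mulVecLin_add {r : ℕ} {ι κ μ : Type*} [Fintype κ] [Fintype μ]
    {v : κ → ℤ} {u : μ → ℤ}
    (A : Matrix ι κ (MvPolynomial (Fin r) K)) {B : Matrix κ μ (MvPolynomial (Fin r) K)}
    (hB : ∀ i j, B i j ∈ hcomp K r (u j - v i))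
    (hAB : LinearMap.ker A.mulVecLin = LinearMap.range B.mulVecLin) (t : ℤ) :
    Module.finrank K ((freePiece K r v t).map (A.mulVecLin.restrictScalars K)) +
      Module.finrank K ((freePiece K r u t).map (B.mulVecLin.restrictScalars K)) =
        Module.finrank K (freePiece K r v t) := by
  rw [← Submodule.finrank_map_add_finrank_inf_ker (A.mulVecLin.restrictScalars K)
    (freePiece K r v t)]
  have hker : ∀ x, A.mulVecLin x = 0 ↔ ∃ y, B.mulVecLin y = x := fun x => by
    rw [← LinearMap.mem_ker, hAB, LinearMap.mem_range]
  suffices h : (freePiece K r u t).map (B.mulVecLin.restrictScalars K) =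
      freePiece K r v t ⊓ LinearMap.ker (A.mulVecLin.restrictScalars K) by rw [h]
  apply le_antisymm
  · rintro _ ⟨x, hx, rfl⟩
    exact ⟨mulVec_mem_freePiece hB hx, (hker _).2 ⟨x, rfl⟩⟩
  · rintro x ⟨hx, hx'⟩
    obtain ⟨y, rfl⟩ := (hker x).1 hx'
    obtain ⟨y', hy', h⟩ := exists_freePiece_mulVec_eq hB hx
    exact ⟨y', hy', h⟩

theorem finrank_cokerPiece_add {n m : ℕ} {a : Fin n → ℤ} {b : Fin m → ℤ}
    {φ : Matrix (Fin n) (Fin m) (MvPolynomial (Fin 3) K)}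
    (hφ : ∀ i j, φ i j ∈ hcomp K 3 (b j - a i)) (t : ℤ) :
    Module.finrank K (cokerPiece φ a t) +
      Module.finrank K ((freePiece K 3 b t).map (φ.mulVecLin.restrictScalars K)) =
        Module.finrank K (freePiece K 3 a t) := by
  rw [← Submodule.finrank_map_add_finrank_inf_ker
    ((LinearMap.range φ.mulVecLin).mkQ.restrictScalars K) (freePiece K 3 a t)]
  suffices h : (freePiece K 3 b t).map (φ.mulVecLin.restrictScalars K) = freePiece K 3 a t ⊓
      LinearMap.ker ((LinearMap.range φ.mulVecLin).mkQ.restrictScalars K) by rw [h]; rfl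
  apply le_antisymm
  · rintro _ ⟨x, hx, rfl⟩
    exact ⟨mulVec_mem_freePiece hφ hx, (Submodule.Quotient.mk_eq_zero _).2 ⟨x, rfl⟩⟩
  · rintro x ⟨hx, hx'⟩
    obtain ⟨y, rfl⟩ := (Submodule.Quotient.mk_eq_zero _).1 hx'
    obtain ⟨y', hy', h⟩ := exists_freePiece_mulVec_eq hφ hx
    exact ⟨y', hy', h⟩

theorem two_mul_finrank_hcomp (z : ℤ) :
    2 * (Module.finrank K (hcomp K 3 z) : ℤ) = if 0 ≤ z then (z + 1) * (z + 2) else 0 := by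
  split_ifs with hz
  · lift z to ℕ using hz
    have h1 : {d : Fin 3 →₀ ℕ | d.degree = z} =
        ((Finset.univ : Finset (Fin 3)).finsuppAntidiag z : Set (Fin 3 →₀ ℕ)) := by
      ext d
      simp [Finsupp.degree_eq_sum]
    have h2 : Module.finrank K (hcomp K 3 z) = (z + 2).choose 2 := by
      rw [hcomp, if_pos (by omega), Int.toNat_natCast, homogeneousSubmodule_eq_finsupp_supported,
        h1, (AddMonoidAlgebra.supportedEquivFinsupp _).finrank_eq, Module.finrank_finsupp_self]
      have := Finset.card_finsuppAntidiag_nat_eq_choose (s := (Finset.univ : Finset (Fin 3))) z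
      simp only [Finset.card_univ, Fintype.card_fin] at this
      rw [show 3 + z - 1 = z + 2 by omega] at this
      simpa [this] using Nat.choose_symm_add
    rw [h2]
    have h4 : (z + 2).choose 2 * 2 = (z + 2) * (z + 1) := by
      rw [Nat.choose_two_right]
      exact Nat.div_mul_cancel (by simpa using (Nat.even_mul_pred_self (z + 2)).two_dvd)
    push_cast [← Nat.cast_inj (R := ℤ)] at h4
    linarith
  · rw [hcomp_of_neg (by omega)]
    simp

end Degree

section HilbertFunction

/-- Twice the Hilbert polynomial of `K[x, y, z]`, extended by zero to negative degrees. -/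
def twiceHilbert (z : ℤ) : ℤ := if 0 ≤ z then (z + 1) * (z + 2) else 0

theorem twiceHilbert_add (z : ℤ) : twiceHilbert z + twiceHilbert (-3 - z) = (z + 1) * (z + 2) := by
  rw [twiceHilbert, twiceHilbert]
  split_ifs
  · omega
  · ring
  · ring
  · obtain rfl | rfl : z = -1 ∨ z = -2 := by omega
    all_goals norm_num

theorem twiceHilbert_succ (z : ℤ) :
    twiceHilbert (z + 1) = twiceHilbert z + 2 * max (z + 2) 0 := by
  rw [twiceHilbert, twiceHilbert]
  split_ifs
  · rw [max_eq_left (by omega)]; ring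
  · obtain rfl : z = -1 := by omega
    norm_num
  · omega
  · rw [max_eq_right (by omega)]; ring

theorem two_mul_finrank_cokerPiece {K : Type*} [Field K] {n : ℕ} {a : Fin n → ℤ}
    {b : Fin (n + 2) → ℤ} {φ : Matrix (Fin n) (Fin (n + 2)) (MvPolynomial (Fin 3) K)}
    (hφ : ∀ i j, φ i j ∈ hcomp K 3 (b j - a i)) {N : ℕ}
    (hN : ∀ i, (X i : MvPolynomial (Fin 3) K) ^ N ∈ skewMinorsIdeal φ) {d : ℤ}
    (hd : d = ∑ j, b j - ∑ i, a i) (t : ℤ) :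
    2 * (Module.finrank K (cokerPiece φ a t) : ℤ) =
      ∑ i, (twiceHilbert (t - a i) - twiceHilbert (t - d + a i)) -
        ∑ j, (twiceHilbert (t - b j) - twiceHilbert (t - d + b j)) := by
  have hS : ∀ j k, skewMinors φ j k ∈ hcomp K 3 (d - b k - b j) := fun j k =>
    hd ▸ skewMinors_mem_hcomp φ a b hφ j k
  have hT : ∀ j i, φᵀ j i ∈ hcomp K 3 (d - a i - (d - b j)) := fun j i => by
    rw [show d - a i - (d - b j) = b j - a i by ring]
    exact hφ i j
  have H := isKoszulRegular_X_pow (K := K) N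
  have e1 := finrank_cokerPiece_add hφ t
  have e2 := finrank_map_mulVecLin_add φ hS
    (ker_mulVecLin_eq_range_skewMinors φ H (hN 0) (hN 1) (hN 2)) t
  have e3 := finrank_map_mulVecLin_add (v := fun k => d - b k) (u := fun i => d - a i)
    (skewMinors φ) hT (ker_skewMinors_eq_range φ H (hN 0) (hN 1)) t
  have e4 := Submodule.finrank_map_add_finrank_inf_ker (φᵀ.mulVecLin.restrictScalars K)
    (freePiece K 3 (fun i => d - a i) t)
  have hker : LinearMap.ker (φᵀ.mulVecLin.restrictScalars K) = ⊥ :=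
    LinearMap.ker_eq_bot.2 (LinearMap.ker_eq_bot (f := φᵀ.mulVecLin).1
      (ker_transpose_mulVecLin_eq_bot φ (hN 0) H.ne_zero))
  rw [hker, inf_bot_eq, finrank_bot, add_zero] at e4
  have hfree : ∀ {m : ℕ} (w : Fin m → ℤ), ∑ i, twiceHilbert (t - w i) =
      2 * (Module.finrank K (freePiece K 3 w t) : ℤ) := fun w => by
    rw [finrank_freePiece]
    push_cast
    rw [Finset.mul_sum]
    exact Finset.sum_congr rfl fun i _ => (two_mul_finrank_hcomp _).symm
  simp only [Finset.sum_sub_distrib, show ∀ x, t - d + x = t - (d - x) from fun x => by ring]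
  rw [hfree a, hfree b, hfree fun i => d - a i, hfree fun j => d - b j]
  omega

theorem sum_max_sub_lt {n : ℕ} (hn : 0 < n) {a : Fin n → ℤ} {b : Fin (n + 2) → ℤ}
    (hb : Monotone b) (hab : ∀ i : Fin n, a i < b (Fin.castLE (by omega) i)) {u : ℤ}
    (hau : a ⟨0, hn⟩ < u) (hbu : b ⟨n + 1, by omega⟩ + u < ∑ j, b j - ∑ i, a i)
    (hu : 2 * u < ∑ j, b j - ∑ i, a i) :
    ∑ j, max (u - b j) 0 < ∑ i, max (u - a i) 0 := by
  rw [Fin.sum_univ_castSucc, Fin.sum_univ_castSucc] at hbu hu ⊢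
  have hlast : b (Fin.last n).castSucc ≤ b (Fin.last (n + 1)) := hb (Fin.le_last _)
  change b (Fin.last (n + 1)) + u < _ at hbu
  change ∀ i : Fin n, a i < b i.castSucc.castSucc at hab
  rcases le_or_gt u (b (Fin.last n).castSucc) with h | h
  · rw [max_eq_right (a := u - b (Fin.last n).castSucc) (by omega),
      max_eq_right (a := u - b (Fin.last (n + 1))) (by omega), add_zero, add_zero]
    refine Finset.sum_lt_sum (fun i _ => ?_) ⟨⟨0, hn⟩, Finset.mem_univ _, ?_⟩
    · have := hab i
      omega
    · have := hab ⟨0, hn⟩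
      omega
  · have hi : ∀ i : Fin n, b i.castSucc.castSucc < u := fun i =>
      (hb (Fin.castSucc_le_castSucc_iff.2 (Fin.le_last _))).trans_lt h
    have h1 : ∑ i, max (u - a i) 0 = ∑ i, (u - a i) := Finset.sum_congr rfl fun i _ =>
      max_eq_left (by have := hab i; have := hi i; omega)
    have h2 : ∑ i : Fin n, max (u - b i.castSucc.castSucc) 0 =
        ∑ i : Fin n, (u - b i.castSucc.castSucc) := Finset.sum_congr rfl fun i _ =>
      max_eq_left (by have := hi i; omega)
    rw [h1, h2, Finset.sum_sub_distrib, Finset.sum_sub_distrib]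
    omega

end HilbertFunction

end

/-- Suppose `char K ≠ 2` and `a₁ = 0`.  Set `d = ∑ b j - ∑ a i`,
`d' = ∑_{i=1}^n (b i - a i)` and `c = d - 3`.  If either (a) `d` is even and
`d' + b_{n+1} + 2 > b_{n+2}`, or (b) `d` is odd and `d' + b_{n+1} + 1 > b_{n+2}`,
then the Hilbert function of `M = coker φ` is strictly unimodal with maximum at
`⌊c/2⌋`: `h_M(t) < h_M(t+1)` for `0 ≤ t < ⌊c/2⌋`, and `h_M(t) = h_M(c - t)` for
all `t`.  (Note that `/` on `ℤ` is floor division by a positive integer.) -/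
theorem stmt8 {K : Type*} [Field K] [IsAlgClosed K] (hchar : ringChar K ≠ 2)
    (n : ℕ) (hn : 0 < n) (a : Fin n → ℤ) (b : Fin (n + 2) → ℤ)
    (ha : Monotone a) (hb : Monotone b)
    (φ : Matrix (Fin n) (Fin (n + 2)) (MvPolynomial (Fin 3) K))
    (hφ : ∀ i j, φ i j = 0 ∨
      (0 < b j - a i ∧ (φ i j).IsHomogeneous (b j - a i).toNat))
    (I : Ideal (MvPolynomial (Fin 3) K))
    (hI : I = Ideal.span {m | ∃ g : Fin n → Fin (n + 2),
        Function.Injective g ∧ m = (φ.submatrix id g).det})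
    (hht : idealHeight I = 3)
    (ha1 : a ⟨0, hn⟩ = 0)
    (d d' c : ℤ)
    (hd : d = (∑ j, b j) - ∑ i, a i)
    (hd' : d' = ∑ i : Fin n, (b (Fin.castLE (by omega) i) - a i))
    (hc : c = d - 3)
    (hcond : (Even d ∧ b ⟨n + 1, by omega⟩ < d' + b ⟨n, by omega⟩ + 2) ∨
             (Odd d ∧ b ⟨n + 1, by omega⟩ < d' + b ⟨n, by omega⟩ + 1)) :
    (∀ t : ℤ, 0 ≤ t → t < c / 2 →
      Module.finrank K (cokerPiece φ a t) < Module.finrank K (cokerPiece φ a (t + 1))) ∧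
    (∀ t : ℤ, Module.finrank K (cokerPiece φ a t)
      = Module.finrank K (cokerPiece φ a (c - t))) := by
  subst hI hc
  have hφ' : ∀ i j, φ i j ∈ hcomp K 3 (b j - a i) := fun i j => by
    rcases hφ i j with h | ⟨h, h'⟩
    · exact h ▸ zero_mem _
    · exact (mem_hcomp_of_isHomogeneous h.le).2 h'
  obtain ⟨N, hN⟩ := exists_X_pow_mem (isHomogeneous_span_minors φ a b hφ') hht
  replace hN : ∀ i, (X i : MvPolynomial (Fin 3) K) ^ N ∈ skewMinorsIdeal φ := fun i =>
    Ideal.span_le.2 (by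
      rintro _ ⟨g, hg, rfl⟩
      exact det_submatrix_mem_span_skewMinors φ g hg) (hN i)
  have hab := diagonal_degree_pos ha hb φ hφ'
    (fun i j hji => (hφ i j).resolve_right fun h => by omega) hN
  have hM := two_mul_finrank_cokerPiece hφ' hN hd
  have hdsum : d = d' + b ⟨n, by omega⟩ + b ⟨n + 1, by omega⟩ := by
    rw [hd, hd', Fin.sum_univ_castSucc, Fin.sum_univ_castSucc, Finset.sum_sub_distrib]
    change ∑ i : Fin n, b i.castSucc.castSucc + b ⟨n, _⟩ + b ⟨n + 1, _⟩ - _ =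
      ∑ i : Fin n, b i.castSucc.castSucc - _ + _ + _
    ring
  have hbd : 2 * b ⟨n + 1, by omega⟩ ≤ d := by
    rcases hcond with ⟨⟨k, hk⟩, h⟩ | ⟨-, h⟩ <;> omega
  have hble : ∀ j, b j ≤ b ⟨n + 1, by omega⟩ := fun j => hb (Fin.le_last j)
  constructor
  · intro t ht0 htc
    have hu : 2 * (t + 2) < d := by omega
    have hlt := sum_max_sub_lt hn hb hab (u := t + 2) (by omega) (by omega) (by omega)
    have hstep : ∀ x, x ≤ b ⟨n + 1, by omega⟩ →
        twiceHilbert (t + 1 - x) - twiceHilbert (t + 1 - d + x) =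
          twiceHilbert (t - x) - twiceHilbert (t - d + x) + 2 * max (t + 2 - x) 0 := by
      intro x hx
      rw [show t + 1 - x = t - x + 1 by ring, show t + 1 - d + x = t - d + x + 1 by ring,
        twiceHilbert_succ, twiceHilbert_succ, max_eq_right (a := t - d + x + 2) (by omega),
        show t - x + 2 = t + 2 - x by ring]
      ring
    have h1 := hM t
    have h2 := hM (t + 1)
    rw [Finset.sum_congr rfl fun i _ => hstep (a i) ((hab i).le.trans (hble _)),
      Finset.sum_congr rfl fun j _ => hstep (b j) (hble j), Finset.sum_add_distrib,
      Finset.sum_add_distrib, ← Finset.mul_sum, ← Finset.mul_sum] at h2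
    omega
  · intro t
    have hsymm : ∀ x, twiceHilbert (t - x) - twiceHilbert (t - d + x) =
        twiceHilbert (d - 3 - t - x) - twiceHilbert (d - 3 - t - d + x) +
          (d - 2 * x) * (2 * t - d + 3) := by
      intro x
      have h1 := twiceHilbert_add (t - x)
      have h2 := twiceHilbert_add (d - 3 - t - x)
      rw [show -3 - (t - x) = d - 3 - t - d + x by ring] at h1
      rw [show -3 - (d - 3 - t - x) = t - d + x by ring] at h2
      linear_combination h1 - h2
    have h1 := hM t
    have h2 := hM (d - 3 - t)
    rw [Finset.sum_congr rfl fun i _ => hsymm (a i), Finset.sum_congr rfl fun j _ => hsymm (b j),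
      Finset.sum_add_distrib, Finset.sum_add_distrib, ← Finset.sum_mul, ← Finset.sum_mul] at h1
    have h3 : ∀ {m : ℕ} (w : Fin m → ℤ), ∑ i, (d - 2 * w i) = m * d - 2 * ∑ i, w i := fun w => by
      rw [Finset.sum_sub_distrib, ← Finset.mul_sum]
      simp
    rw [h3, h3] at h1
    push_cast at h1
    have : 2 * (Module.finrank K (cokerPiece φ a t) : ℤ) =
        2 * (Module.finrank K (cokerPiece φ a (d - 3 - t)) : ℤ) := by
      linear_combination h1 - h2 - 2 * (2 * t - d + 3) * hd
    omega
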